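/- arXiv:2601.01929 — 2 statements merged into one kernel-verified Lean document; each statement's English description precedes it below -/
import Mathlib

section
/- If n ≥ 2k, t ≥ 2, and ℱ₁, …, ℱ_t ⊆ binomial([n],k) are nonempty pairwise cross intersecting families, then Σᵢ |ℱᵢ| ≤ max{ C(n,k) − C(n−k,k) + t − 1, t·C(n−1,k−1) }. -/
open Finset

/-- Lexicographic order on finite sets: `A ≼ B` iff `A ⊇ B` or `min (A \ B) < min (B \ A)`. -/
def lexLE (A B : Finset ℕ) : Prop := B ⊆ A ∨ (A \ B).min < (B \ A).min

instance : DecidableRel lexLE := fun A B => by unfold lexLE; infer_instance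

/-- The family of all `k`-element subsets of `[n] = {1,…,n}`. -/
def ksubsets (n k : ℕ) : Finset (Finset ℕ) := (Finset.Icc 1 n).powersetCard k

/-- Two families are cross intersecting. -/
def crossInt (A B : Finset (Finset ℕ)) : Prop := ∀ X ∈ A, ∀ Y ∈ B, (X ∩ Y).Nonempty

/-- `ℒ([n], R, k)`: all `k`-subsets of `[n]` lexicographically no more than `R`. -/
def Lfam (n : ℕ) (R : Finset ℕ) (k : ℕ) : Finset (Finset ℕ) :=
  (ksubsets n k).filter (fun F => lexLE F R)

/-- `ℒ([n], r, k)`: the first `r` sets of `binomial([n],k)` in lexicographic order. -/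
def Lnum (n r k : ℕ) : Finset (Finset ℕ) :=
  (ksubsets n k).filter (fun F => ((ksubsets n k).filter (fun G => lexLE G F)).card ≤ r)

/-- `F` and `H` are partners: they strongly intersect at their last element. -/
def isPartner (F H : Finset ℕ) : Prop := ∃ q, F ∩ H = {q} ∧ F ∪ H = Finset.Icc 1 q

/-- `K` is the `k`-partner of `F` (inside `[n]`). -/
def isKPartner (n : ℕ) (F : Finset ℕ) (k : ℕ) (K : Finset ℕ) : Prop :=
  ∃ H, isPartner F H ∧
    ((k = H.card ∧ K = H) ∨
     (H.card < k ∧ K = H ∪ Finset.Icc (n - k + H.card + 1) n) ∨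
     (k < H.card ∧ K ∈ ksubsets n k ∧ lexLE K H ∧
        ∀ K' ∈ ksubsets n k, lexLE K' H → lexLE K' K))

/-- `ℓ(F)`: the length of the maximal tail interval `[n-ℓ+1, n] ⊆ F`. -/
def tailLen (n : ℕ) (F : Finset ℕ) : ℕ :=
  ((Finset.range (n + 1)).filter (fun x => Finset.Icc (n - x + 1) n ⊆ F)).sup id

/-- `F^t = [n - ℓ(F) + 1, n]`. -/
def tailSet (n : ℕ) (F : Finset ℕ) : Finset ℕ := Finset.Icc (n - tailLen n F + 1) n

/-- `𝒜` (a family of `f`-subsets of `[n]`) is maximal with respect to `ℬ`. -/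
def maximalTo (n f : ℕ) (A B : Finset (Finset ℕ)) : Prop :=
  ∀ A' ⊆ ksubsets n f, A ⊆ A' → crossInt A' B → A' = A

/-- The pair of sets `(A, B)` is maximal. -/
def pairMaximal (n : ℕ) (A B : Finset ℕ) : Prop :=
  crossInt (Lfam n A A.card) (Lfam n B B.card) ∧
  maximalTo n A.card (Lfam n A A.card) (Lfam n B B.card) ∧
  maximalTo n B.card (Lfam n B B.card) (Lfam n A A.card)

/-- `A` is the `|A|`-parity of `B`: same set after removing tails, and
`ℓ(B) - ℓ(A) = |B| - |A|` (stated additively). -/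
def isParity (n : ℕ) (A B : Finset ℕ) : Prop :=
  A \ tailSet n A = B \ tailSet n B ∧ tailLen n A + B.card = tailLen n B + A.card

open scoped FinsetFamily

lemma exists_isInitSeg (N l j : ℕ) (hj : j ≤ N.choose l) :
    ∃ C : Finset (Finset (Fin N)), Finset.Colex.IsInitSeg C l ∧ C.card = j := by
  induction j with
  | zero => exact ⟨∅, Finset.Colex.isInitSeg_empty, rfl⟩
  | succ j ih =>
    obtain ⟨C, hC, hCj⟩ := ih (by omega)
    have hsub : C ⊆ powersetCard l univ := fun s hs =>
      mem_powersetCard.2 ⟨subset_univ _, hC.1 hs⟩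
    have hne : (powersetCard l (univ : Finset (Fin N)) \ C).Nonempty := by
      rw [← card_pos, card_sdiff_of_subset hsub, card_powersetCard, card_univ, Fintype.card_fin]
      omega
    obtain ⟨s, hs, hmin⟩ := exists_min_image _ (fun s => toColex s) hne
    rw [mem_sdiff, mem_powersetCard] at hs
    refine ⟨insert s C, ⟨?_, ?_⟩, by rw [card_insert_of_notMem hs.2, hCj]⟩
    · intro t ht
      rw [mem_coe, mem_insert] at ht
      rcases ht with rfl | ht
      · exact hs.1.2
      · exact hC.1 ht
    · rintro u t hu ⟨htu, htl⟩
      rw [mem_insert] at hu ⊢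
      right
      rcases hu with rfl | hu
      · by_contra htC
        exact absurd (hmin t (mem_sdiff.2 ⟨mem_powersetCard.2 ⟨subset_univ _, htl⟩, htC⟩))
          (not_le.2 htu)
      · exact hC.2 hu ⟨htu, htl⟩

lemma isInitSeg_Iio (N l : ℕ) (α : Fin N) :
    Finset.Colex.IsInitSeg (powersetCard l (Iio α)) l := by
  refine ⟨fun s hs => (mem_powersetCard.1 hs).2, ?_⟩
  rintro s t hs ⟨hts, htl⟩
  rw [mem_powersetCard] at hs ⊢
  refine ⟨fun x hx => mem_Iio.2 ?_, htl⟩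
  exact Finset.Colex.forall_lt_mono hts.le (fun b hb => mem_Iio.1 (hs.1 hb)) x hx

lemma isInitSeg_Iic (N l : ℕ) (α : Fin N) :
    Finset.Colex.IsInitSeg (powersetCard l (Iic α)) l := by
  refine ⟨fun s hs => (mem_powersetCard.1 hs).2, ?_⟩
  rintro s t hs ⟨hts, htl⟩
  rw [mem_powersetCard] at hs ⊢
  refine ⟨fun x hx => mem_Iic.2 ?_, htl⟩
  exact Finset.Colex.forall_le_mono hts.le (fun b hb => mem_Iic.1 (hs.1 hb)) x hx

/-- Piecewise linear lower bound for the shadow. -/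
lemma shadow_lower (N s d : ℕ) (α : Fin N) (hα : (α : ℕ) = s + 1 + d)
    (G : Finset (Finset (Fin N))) (hG : (G : Set (Finset (Fin N))).Sized (s + 2))
    (h0 : 0 < G.card)
    (h1 : (α : ℕ).choose (s + 2) ≤ G.card) (h2 : G.card ≤ ((α : ℕ) + 1).choose (s + 2)) :
    (α : ℕ).choose (s + 1) * (d + 1) + (G.card - (α : ℕ).choose (s + 2)) * (s + 1)
      ≤ (∂ G).card * (d + 1) := by
  have hGN : G.card ≤ N.choose (s + 2) :=
    h2.trans (Nat.choose_le_choose _ α.2)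
  obtain ⟨C, hC, hCG⟩ := exists_isInitSeg N (s + 2) G.card hGN
  have hkk := Finset.kruskal_katona hG hCG.le hC
  refine le_trans ?_ (Nat.mul_le_mul_right _ hkk)
  rw [← hCG] at h0 h1 h2 ⊢
  have hlow : powersetCard (s + 2) (Iio α) ⊆ C := by
    rcases (isInitSeg_Iio N (s + 2) α).total hC with h | h
    · exact h
    · exact (eq_of_subset_of_card_le h (by rw [card_powersetCard, Fin.card_Iio]; exact h1)).ge
  have hup : C ⊆ powersetCard (s + 2) (Iic α) := by
    rcases (isInitSeg_Iic N (s + 2) α).total hC with h | h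
    · exact (eq_of_subset_of_card_le h (by rw [card_powersetCard, Fin.card_Iic]; exact h2)).ge
    · exact h
  set D := C.filter (fun t => α ∈ t) with hD
  set E := (∂ C).filter (fun t => α ∈ t) with hE
  have hCD : C.card = (α : ℕ).choose (s + 2) + D.card := by
    rw [← card_filter_add_card_filter_not (s := C) (fun t => α ∈ t), add_comm]
    congr 1
    have : C.filter (fun t => ¬ α ∈ t) = powersetCard (s + 2) (Iio α) := by
      ext t
      rw [mem_filter]
      constructor
      · rintro ⟨ht, hat⟩
        have := mem_powersetCard.1 (hup ht)
        refine mem_powersetCard.2 ⟨fun x hx => mem_Iio.2 ?_, this.2⟩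
        refine lt_of_le_of_ne (mem_Iic.1 (this.1 hx)) ?_
        rintro rfl
        exact hat hx
      · intro ht
        refine ⟨hlow ht, fun h => ?_⟩
        exact absurd (mem_Iio.1 ((mem_powersetCard.1 ht).1 h)) (lt_irrefl _)
    rw [this, card_powersetCard, Fin.card_Iio]
  have hshE : (α : ℕ).choose (s + 1) + E.card ≤ (∂ C).card := by
    rw [← card_filter_add_card_filter_not (s := ∂ C) (fun t => α ∈ t), add_comm]
    refine Nat.add_le_add_left ?_ _
    have : powersetCard (s + 1) (Iio α) ⊆ (∂ C).filter (fun t => ¬ α ∈ t) := by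
      intro t ht
      rw [mem_powersetCard] at ht
      rw [mem_filter]
      refine ⟨?_, fun h => absurd (mem_Iio.1 (ht.1 h)) (lt_irrefl _)⟩
      by_cases hd : d = 0
      · obtain ⟨u, hu⟩ := card_pos.1 h0
        have hu' := mem_powersetCard.1 (hup hu)
        have : u = Iic α := eq_of_subset_of_card_le hu'.1 (by
          rw [Fin.card_Iic, hu'.2]; omega)
        refine mem_shadow_iff_exists_mem_card_add_one.2 ⟨u, hu, ?_, ?_⟩
        · rw [this]; exact fun x hx => mem_Iic.2 (mem_Iio.1 (ht.1 hx)).le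
        · rw [hu'.2, ht.2]
      · have : (Iio α \ t).Nonempty := by
          rw [← card_pos, card_sdiff_of_subset ht.1, Fin.card_Iio]
          omega
        obtain ⟨x, hx⟩ := this
        rw [mem_sdiff] at hx
        refine mem_shadow_iff_insert_mem.2 ⟨x, hx.2, hlow (mem_powersetCard.2 ⟨?_, ?_⟩)⟩
        · exact insert_subset hx.1 ht.1
        · rw [card_insert_of_notMem hx.2, ht.2]
    have := card_le_card this
    rwa [card_powersetCard, Fin.card_Iio] at this
  have hDE : D.card * (s + 1) ≤ E.card * (d + 1) := by
    refine card_mul_le_card_mul (fun u t => t ⊆ u) ?_ ?_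
    · intro u hu
      rw [hD, mem_filter] at hu
      have hu' := mem_powersetCard.1 (hup hu.1)
      have himg : (u.erase α).image (fun x => u.erase x) ⊆
          E.bipartiteAbove (fun u t => t ⊆ u) u := by
        intro t ht
        obtain ⟨x, hx, rfl⟩ := mem_image.1 ht
        rw [mem_erase] at hx
        rw [mem_bipartiteAbove, hE, mem_filter]
        exact ⟨⟨erase_mem_shadow hu.1 hx.2, mem_erase.2 ⟨hx.1.symm, hu.2⟩⟩, erase_subset _ _⟩
      have hc := card_le_card himg
      rw [card_image_of_injOn, card_erase_of_mem hu.2, hu'.2] at hc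
      · omega
      · exact (erase_injOn u).mono (by exact_mod_cast erase_subset _ _)
    · intro t ht
      rw [hE, mem_filter] at ht
      obtain ⟨v, hv, htv, hcard⟩ := mem_shadow_iff_exists_mem_card_add_one.1 ht.1
      have hv' := mem_powersetCard.1 (hup hv)
      have htc : t.card = s + 1 := by omega
      have htI : t ⊆ Iic α := htv.trans hv'.1
      have himg : D.bipartiteBelow (fun u t => t ⊆ u) t ⊆
          (Iic α \ t).image (fun x => insert x t) := by
        intro u hu
        rw [mem_bipartiteBelow, hD, mem_filter] at hu
        have hu' := mem_powersetCard.1 (hup hu.1.1)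
        obtain ⟨x, hxt, hxu⟩ := exists_eq_insert_iff.2 ⟨hu.2, by rw [htc, hu'.2]⟩
        refine mem_image.2 ⟨x, mem_sdiff.2 ⟨hu'.1 ?_, hxt⟩, hxu⟩
        rw [← hxu]; exact mem_insert_self _ _
      have hc := (card_le_card himg).trans card_image_le
      rw [card_sdiff_of_subset htI, Fin.card_Iic, htc] at hc
      omega
  have h3 : C.card - (α : ℕ).choose (s + 2) = D.card := by omega
  rw [h3]
  nlinarith

lemma tangent (s d b : ℕ) (hb : s + 1 ≤ b) :
    ((d : ℝ) + 1) * ((b.choose (s + 1) : ℝ) - ((s + 1 + d).choose (s + 1) : ℝ)) ≤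
      ((s : ℝ) + 1) * ((b.choose (s + 2) : ℝ) - ((s + 1 + d).choose (s + 2) : ℝ)) := by
  have key : ∀ e : ℕ, ((e : ℝ) + 1) * ((s + 1 + e).choose s : ℝ) = 
     ((s : ℝ) + 1) * ((s + 1 + e).choose (s + 1) : ℝ) := by
    intro e
    have h := Nat.choose_succ_right_eq (s + 1 + e) s
    rw [show s + 1 + e - s = e + 1 by omega] at h
    have h' : (((s + 1 + e).choose (s + 1) * (s + 1) : ℕ) : ℝ) =
      (((s + 1 + e).choose s * (e + 1) : ℕ) : ℝ) := by rw [h]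
    push_cast at h'
    linarith
  obtain ⟨e, rfl⟩ := Nat.exists_eq_add_of_le hb
  let f : ℕ → ℝ := fun e => ((s : ℝ) + 1) * ((s + 1 + e).choose (s + 2) : ℝ) -
    ((d : ℝ) + 1) * ((s + 1 + e).choose (s + 1) : ℝ)
  have hstep : ∀ e, f (e + 1) - f e = ((e : ℝ) - d) * ((s + 1 + e).choose s : ℝ) := by
    intro e
    have h1 : (s + 1 + (e + 1)).choose (s + 2) =
      (s + 1 + e).choose (s + 1) + (s + 1 + e).choose (s + 2) := Nat.choose_succ_succ _ _
    have h2 : (s + 1 + (e + 1)).choose (s + 1) =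
      (s + 1 + e).choose s + (s + 1 + e).choose (s + 1) := Nat.choose_succ_succ _ _
    simp only [f, h1, h2]
    push_cast
    linarith [key e]
  have hmain : f d ≤ f e := by
    rcases le_total d e with h | h
    · induction e, h using Nat.le_induction with
      | base => exact le_rfl
      | succ e hde ih =>
        have : (0 : ℝ) ≤ ((e : ℝ) - d) * ((s + 1 + e).choose s : ℝ) :=
          mul_nonneg (sub_nonneg.2 (by exact_mod_cast hde)) (by positivity)
        linarith [hstep e, ih (by omega)]
    · have hdec : ∀ j, j ≤ d → f d ≤ f (d - j) := by
        intro j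
        induction j with
        | zero => intro _; exact le_rfl
        | succ j ih =>
          intro hj
          have h1 := hstep (d - (j + 1))
          rw [show d - (j + 1) + 1 = d - j by omega] at h1
          have : ((d - (j + 1) : ℕ) : ℝ) - d ≤ 0 := sub_nonpos.2 (by exact_mod_cast Nat.sub_le _ _)
          have h3 := mul_nonpos_of_nonpos_of_nonneg this
            (Nat.cast_nonneg (α := ℝ) ((s + 1 + (d - (j + 1))).choose s))
          linarith [ih (by omega)]
      have := hdec (d - e) (Nat.sub_le _ _)
      rwa [Nat.sub_sub_self h] at this
  simp only [f] at hmain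
  linarith

lemma shadow_step (N s q m : ℕ) (hq : s + 2 ≤ q) (hm : s + 2 ≤ m) (θ : ℝ) (h0 : 0 ≤ θ)
    (h1 : θ ≤ 1) (G : Finset (Finset (Fin N)))
    (hG : (G : Set (Finset (Fin N))).Sized (s + 2))
    (hc : (1 - θ) * (q.choose (s + 2) : ℝ) + θ * (m.choose (s + 2) : ℝ) ≤ G.card) :
    (1 - θ) * (q.choose (s + 1) : ℝ) + θ * (m.choose (s + 1) : ℝ) ≤ (∂ G).card := by
  have hq1 : (1 : ℝ) ≤ (q.choose (s + 2) : ℝ) := by exact_mod_cast Nat.choose_pos hq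
  have hm1 : (1 : ℝ) ≤ (m.choose (s + 2) : ℝ) := by exact_mod_cast Nat.choose_pos hm
  have hpos : 0 < G.card := by
    have : (1 : ℝ) ≤ G.card := by nlinarith
    exact_mod_cast this
  have hGN : G.card ≤ N.choose (s + 2) := by
    have : G ⊆ powersetCard (s + 2) univ := fun u hu => mem_powersetCard.2 ⟨subset_univ _, hG hu⟩
    have := card_le_card this
    rwa [card_powersetCard, card_univ, Fintype.card_fin] at this
  have hN : s + 2 ≤ N := by
    by_contra h
    rw [Nat.choose_eq_zero_of_lt (by omega)] at hGN
    omega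
  set a := Nat.findGreatest (fun a => a.choose (s + 2) ≤ G.card) (N - 1) with ha
  have hs1 : s + 1 ≤ a := Nat.le_findGreatest (by omega)
    (by rw [Nat.choose_eq_zero_of_lt (by omega)]; omega)
  have ha1 : a.choose (s + 2) ≤ G.card :=
    Nat.findGreatest_spec (P := fun a => a.choose (s + 2) ≤ G.card) (Nat.zero_le (N - 1)) (by simp)
  have haN : a ≤ N - 1 := Nat.findGreatest_le _
  have ha2 : G.card ≤ (a + 1).choose (s + 2) := by
    by_cases h : a = N - 1
    · rw [h, show N - 1 + 1 = N by omega]; exact hGN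
    · have := Nat.findGreatest_is_greatest (P := fun a => a.choose (s + 2) ≤ G.card)
        (n := N - 1) (k := a + 1) (by omega) (by omega)
      omega
  obtain ⟨d, hd⟩ := Nat.exists_eq_add_of_le hs1
  have hlow := shadow_lower N s d ⟨a, by omega⟩ hd G hG hpos ha1 ha2
  simp only at hlow
  have hlow' : (a.choose (s + 1) : ℝ) * (d + 1) + ((G.card : ℝ) - a.choose (s + 2)) * (s + 1)
      ≤ (∂ G).card * (d + 1) := by
    have : ((a.choose (s + 1) * (d + 1) + (G.card - a.choose (s + 2)) * (s + 1) : ℕ) : ℝ)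
      ≤ (((∂ G).card * (d + 1) : ℕ) : ℝ) := by exact_mod_cast hlow
    push_cast [Nat.cast_sub ha1] at this
    exact this
  have tq := tangent s d q (by omega)
  have tm := tangent s d m (by omega)
  rw [← hd] at tq tm
  have e1 := mul_le_mul_of_nonneg_left tq (sub_nonneg.2 h1)
  have e2 := mul_le_mul_of_nonneg_left tm h0
  have e3 := mul_le_mul_of_nonneg_left hc (by positivity : (0 : ℝ) ≤ (s : ℝ) + 1)
  have hdpos : (0 : ℝ) < (d : ℝ) + 1 := by positivity
  refine le_of_mul_le_mul_right ?_ hdpos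
  nlinarith

lemma shadow_iter (N p q m : ℕ) (hq : p ≤ q) (hm : p ≤ m) (θ : ℝ) (h0 : 0 ≤ θ)
    (h1 : θ ≤ 1) (G : Finset (Finset (Fin N)))
    (hG : (G : Set (Finset (Fin N))).Sized p)
    (hc : (1 - θ) * (q.choose p : ℝ) + θ * (m.choose p : ℝ) ≤ G.card) (i : ℕ) (hi : i < p) :
    (1 - θ) * (q.choose (p - i) : ℝ) + θ * (m.choose (p - i) : ℝ) ≤ (∂^[i] G).card := by
  induction i with
  | zero => simpa using hc
  | succ i ih =>
    have ih' := ih (by omega)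
    obtain ⟨s, hs⟩ : ∃ s, p - i = s + 2 := ⟨p - i - 2, by omega⟩
    have hsz := hG.shadow_iterate (k := i)
    rw [hs] at ih' hsz
    rw [show p - (i + 1) = s + 1 by omega, Function.iterate_succ_apply']
    exact shadow_step N s q m (by omega) (by omega) θ h0 h1 _ hsz ih'

lemma pair_bound (n k c : ℕ) (hk : 1 ≤ k) (hn : 2 * k ≤ n)
    (A B : Finset (Finset (Fin n))) (hA : (A : Set (Finset (Fin n))).Sized k)
    (hB : (B : Set (Finset (Fin n))).Sized (n - k)) (hBne : B.Nonempty)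
    (hAB : ∀ X ∈ A, ∀ Y ∈ B, ¬ X ⊆ Y) (hle : B.card ≤ A.card) :
    A.card + c * B.card ≤
      max (n.choose k - (n - k).choose k + c) ((c + 1) * (n - 1).choose (k - 1)) := by
  by_cases hsmall : A.card ≤ (n - 1).choose (k - 1)
  · refine le_max_of_le_right ?_
    have := Nat.mul_le_mul_left c (hle.trans hsmall)
    nlinarith
  push Not at hsmall
  have hiter := shadow_iter n (n - k) (n - k) (n - 1) le_rfl (by omega)
  have hdisj : Disjoint A (∂^[n - k - k] B) := by
    rw [Finset.disjoint_left]
    intro X hX hX'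
    obtain ⟨Y, hY, hXY, -⟩ := mem_shadow_iterate_iff_exists_sdiff.1 hX'
    exact hAB X hX Y hY hXY
  have hkk : n - k - (n - k - k) = k := by omega
  have hsz := hB.shadow_iterate (k := n - k - k)
  rw [hkk] at hsz
  have htot : A.card + (∂^[n - k - k] B).card ≤ n.choose k := by
    rw [← card_union_of_disjoint hdisj]
    have : A ∪ ∂^[n - k - k] B ⊆ powersetCard k univ := by
      intro u hu
      refine mem_powersetCard.2 ⟨subset_univ _, ?_⟩
      rcases mem_union.1 hu with h | h
      · exact hA h
      · exact hsz h
    have := card_le_card this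
    rwa [card_powersetCard, card_univ, Fintype.card_fin] at this
  have hpascal : n.choose k = (n - 1).choose (k - 1) + (n - 1).choose k := by
    obtain ⟨k', rfl⟩ := Nat.exists_eq_add_of_le' hk
    obtain ⟨n', rfl⟩ : ∃ n', n = n' + 1 := ⟨n - 1, by omega⟩
    exact Nat.choose_succ_succ _ _
  have hsymm : (n - 1).choose (n - k) = (n - 1).choose (k - 1) := by
    rw [← Nat.choose_symm (by omega : n - k ≤ n - 1)]
    congr 1; omega
  have hBlt : B.card < (n - 1).choose (k - 1) := by
    by_contra h
    push Not at h
    have := hiter 1 zero_le_one le_rfl B hB (by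
      rw [hsymm]; simp only [sub_self, zero_mul, one_mul, zero_add]; exact_mod_cast h)
      (n - k - k) (by omega)
    rw [hkk] at this
    simp only [sub_self, zero_mul, one_mul, zero_add] at this
    have : (n - 1).choose k ≤ (∂^[n - k - k] B).card := by exact_mod_cast this
    omega
  have hB1 : 1 ≤ B.card := card_pos.2 hBne
  set M : ℝ := ((n - 1).choose (k - 1) : ℝ) with hM
  have hMB : (B.card : ℝ) < M := Nat.cast_lt.2 hBlt
  have hB1' : (1 : ℝ) ≤ B.card := by exact_mod_cast hB1
  have hM1 : 0 < M - 1 := by linarith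
  set θ : ℝ := ((B.card : ℝ) - 1) / (M - 1) with hθ
  have hθ0 : 0 ≤ θ := div_nonneg (by linarith) hM1.le
  have hθ1 : θ ≤ 1 := (div_le_one hM1).2 (by linarith)
  have hθB : (1 - θ) + θ * M = B.card := by
    have : θ * (M - 1) = B.card - 1 := div_mul_cancel₀ _ hM1.ne'
    linarith
  have hs := hiter θ hθ0 hθ1 B hB (by
    rw [hsymm, Nat.choose_self]; push_cast; linarith) (n - k - k) (by omega)
  rw [hkk] at hs
  have hle' : (n - k).choose k ≤ n.choose k := Nat.choose_le_choose _ (Nat.sub_le _ _)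
  have htot' : (A.card : ℝ) + (∂^[n - k - k] B).card ≤ n.choose k := by exact_mod_cast htot
  have hpascal' : (n.choose k : ℝ) = M + (n - 1).choose k := by rw [hM]; exact_mod_cast hpascal
  rw [← Nat.cast_le (α := ℝ)]
  push_cast [Nat.cast_sub hle']
  rw [← hM]
  set U : ℝ := max ((n.choose k : ℝ) - (n - k).choose k + c) ((c + 1) * M) with hU
  have u1 := mul_le_mul_of_nonneg_left (le_max_left ((n.choose k : ℝ) - (n - k).choose k + c) ((c + 1) * M)) (sub_nonneg.2 hθ1)
  have u2 := mul_le_mul_of_nonneg_left (le_max_right ((n.choose k : ℝ) - (n - k).choose k + c) ((c + 1) * M)) hθ0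
  rw [← hU] at u1 u2
  rw [← hθB]
  nlinarith

/-- Transfer of subsets of `{1,…,n}` to subsets of `Fin n`. -/
def toFinSet (n : ℕ) (X : Finset ℕ) : Finset (Fin n) := univ.filter (fun i => (i : ℕ) + 1 ∈ X)

lemma toFinSet_map (n : ℕ) (X : Finset ℕ) (hX : X ⊆ Icc 1 n) :
    (toFinSet n X).image (fun i : Fin n => (i : ℕ) + 1) = X := by
  ext x
  simp only [toFinSet, mem_image, mem_filter, mem_univ, true_and]
  constructor
  · rintro ⟨i, hi, rfl⟩
    exact hi
  · intro hx
    have := mem_Icc.1 (hX hx)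
    refine ⟨⟨x - 1, by omega⟩, ?_, ?_⟩
    · simpa [Nat.sub_add_cancel this.1] using hx
    · simp [Nat.sub_add_cancel this.1]

lemma toFinSet_card (n : ℕ) (X : Finset ℕ) (hX : X ⊆ Icc 1 n) :
    (toFinSet n X).card = X.card := by
  conv_rhs => rw [← toFinSet_map n X hX]
  rw [card_image_of_injective]
  intro a b h
  simpa [Fin.ext_iff] using h

lemma toFinSet_inj (n : ℕ) (X Y : Finset ℕ) (hX : X ⊆ Icc 1 n) (hY : Y ⊆ Icc 1 n)
    (h : toFinSet n X = toFinSet n Y) : X = Y := by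
  rw [← toFinSet_map n X hX, ← toFinSet_map n Y hY, h]

lemma pair_bound_nat (n k c : ℕ) (hk : 1 ≤ k) (hn : 2 * k ≤ n)
    (A B : Finset (Finset ℕ)) (hA : A ⊆ ksubsets n k) (hB : B ⊆ ksubsets n k)
    (hBne : B.Nonempty) (hAB : crossInt A B) (hle : B.card ≤ A.card) :
    A.card + c * B.card ≤
      max (n.choose k - (n - k).choose k + c) ((c + 1) * (n - 1).choose (k - 1)) := by
  have hA' : ∀ X ∈ A, X ⊆ Icc 1 n ∧ X.card = k := fun X hX => mem_powersetCard.1 (hA hX)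
  have hB' : ∀ X ∈ B, X ⊆ Icc 1 n ∧ X.card = k := fun X hX => mem_powersetCard.1 (hB hX)
  have hcA : (A.image (toFinSet n)).card = A.card :=
    card_image_of_injOn fun X hX Y hY h => toFinSet_inj n X Y (hA' X hX).1 (hA' Y hY).1 h
  have hcB : (B.image (fun Y => (toFinSet n Y)ᶜ)).card = B.card :=
    card_image_of_injOn fun X hX Y hY h =>
      toFinSet_inj n X Y (hB' X hX).1 (hB' Y hY).1 (compl_injective h)
  have := pair_bound n k c hk hn (A.image (toFinSet n)) (B.image (fun Y => (toFinSet n Y)ᶜ))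
    (by
      intro X hX
      obtain ⟨X', hX', rfl⟩ := mem_image.1 (mem_coe.1 hX)
      rw [toFinSet_card n X' (hA' X' hX').1, (hA' X' hX').2])
    (by
      intro X hX
      obtain ⟨X', hX', rfl⟩ := mem_image.1 (mem_coe.1 hX)
      rw [card_compl, toFinSet_card n X' (hB' X' hX').1, (hB' X' hX').2, Fintype.card_fin])
    (hBne.image _)
    (by
      intro X hX Y hY hXY
      obtain ⟨X', hX', rfl⟩ := mem_image.1 hX
      obtain ⟨Y', hY', rfl⟩ := mem_image.1 hY
      obtain ⟨x, hx⟩ := hAB X' hX' Y' hY'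
      rw [mem_inter] at hx
      have hxn := mem_Icc.1 ((hA' X' hX').1 hx.1)
      have h1 : (⟨x - 1, by omega⟩ : Fin n) ∈ toFinSet n X' := by
        simpa [toFinSet, Nat.sub_add_cancel hxn.1] using hx.1
      have h2 : (⟨x - 1, by omega⟩ : Fin n) ∈ toFinSet n Y' := by
        simpa [toFinSet, Nat.sub_add_cancel hxn.1] using hx.2
      exact mem_compl.1 (hXY h1) h2)
    (by rw [hcA, hcB]; exact hle)
  rwa [hcA, hcB] at this

theorem stmt1 (n k t : ℕ) (hk : 1 ≤ k) (ht : 2 ≤ t) (hn : 2 * k ≤ n)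
    (F : Fin t → Finset (Finset ℕ))
    (hF : ∀ i, F i ⊆ ksubsets n k) (hne : ∀ i, (F i).Nonempty)
    (hcross : ∀ i j, i ≠ j → crossInt (F i) (F j)) :
    ∑ i, (F i).card ≤
      max (n.choose k - (n - k).choose k + (t - 1)) (t * (n - 1).choose (k - 1)) := by
  haveI : Nonempty (Fin t) := ⟨⟨0, by omega⟩⟩
  obtain ⟨i, -, hi⟩ := exists_max_image (univ : Finset (Fin t)) (fun i => (F i).card) univ_nonempty
  have hcard : (univ.erase i).card = t - 1 := by
    rw [card_erase_of_mem (mem_univ i), card_univ, Fintype.card_fin]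
  have hne' : (univ.erase i).Nonempty := by
    rw [← card_pos, hcard]; omega
  obtain ⟨j, hj, hjmax⟩ := exists_max_image (univ.erase i) (fun i => (F i).card) hne'
  have hji : j ≠ i := (mem_erase.1 hj).1
  have hsum : ∑ x, (F x).card ≤ (F i).card + (t - 1) * (F j).card := by
    rw [← add_sum_erase univ (fun x => (F x).card) (mem_univ i)]
    refine Nat.add_le_add_left ?_ _
    have := sum_le_card_nsmul (univ.erase i) (fun x => (F x).card) (F j).card hjmax
    rwa [hcard, smul_eq_mul] at this
  have := pair_bound_nat n k (t - 1) hk hn (F i) (F j) (hF i) (hF j) (hne j)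
    (hcross i j hji.symm) (hi j (mem_univ j))
  rw [Nat.sub_add_cancel (by omega : 1 ≤ t)] at this
  exact hsum.trans this
end

section
/- Let t ≥ 3, k₁ ≥ k₂ ≥ ⋯ ≥ k_t and k₁ + k₃ ≤ n < k₁ + k₂. If ℱ₁ ⊆ binomial([n],k₁), …, ℱ_t ⊆ binomial([n],k_t) are nonempty pairwise cross intersecting families, then Σᵢ₌₁ᵗ |ℱᵢ| ≤ max{ Σᵢ₌₁ᵗ C(n−1, kᵢ−1), (C(n,k₁) − C(n−k_t,k₁)) + (C(n,k₂) − C(n−k_t,k₂)) + Σᵢ₌₃ᵗ C(n−k_t, kᵢ−k_t) }. -/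
open Finset

lemma choose_cross {p i x y : ℕ} (hi : i ≤ p) (hxy : x ≤ y) :
    p.choose x * i.choose y ≤ p.choose y * i.choose x := by
  have h1 := Nat.choose_mul (n := i) hxy
  have h2 := Nat.choose_mul (n := p) hxy
  have h3 : (i - x).choose (y - x) ≤ (p - x).choose (y - x) := Nat.choose_le_choose _ (by omega)
  have h4 : 0 < y.choose x := Nat.choose_pos hxy
  refine Nat.le_of_mul_le_mul_right (c := y.choose x) ?_ h4
  calc p.choose x * i.choose y * y.choose x = p.choose x * (i.choose y * y.choose x) := by ring
    _ = p.choose x * (i.choose x * (i - x).choose (y - x)) := by rw [h1]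
    _ ≤ p.choose x * (i.choose x * (p - x).choose (y - x)) := by gcongr
    _ = (p.choose x * (p - x).choose (y - x)) * i.choose x := by ring
    _ = (p.choose y * y.choose x) * i.choose x := by rw [h2]
    _ = _ := by ring

/-- number of `a`-subsets of a `p`-set meeting a fixed `m`-subset. -/
def II (p a m : ℕ) : ℕ := p.choose a - (p - m).choose a

lemma II_add (p a m : ℕ) : II p a m + (p - m).choose a = p.choose a :=
  Nat.sub_add_cancel (Nat.choose_le_choose _ (by omega))

lemma II_succ_right (p a m : ℕ) (h : m + 1 ≤ p) :
    II p (a+1) (m+1) = II p (a+1) m + (p - (m+1)).choose a := by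
  have h1 := II_add p (a+1) (m+1)
  have h2 := II_add p (a+1) m
  have h3 : p - m = p - (m+1) + 1 := by omega
  rw [h3, Nat.choose_succ_succ'] at h2
  omega

lemma II_succ (p a m : ℕ) : II (p+1) (a+1) (m+1) = p.choose a + II p (a+1) m := by
  have h1 := II_add (p+1) (a+1) (m+1)
  have h2 := II_add p (a+1) m
  rw [Nat.choose_succ_succ', Nat.add_sub_add_right] at h1
  omega

lemma II_cross (p a c m : ℕ) (hm : m ≤ p) (hac : a ≤ c) :
    p.choose a * II p (c+1) m ≤ p.choose c * II p (a+1) m := by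
  induction m with
  | zero => simp [II]
  | succ m ih =>
    rw [II_succ_right _ _ _ hm, II_succ_right _ _ _ hm, mul_add, mul_add]
    exact add_le_add (ih (by omega)) (choose_cross (by omega) hac)

lemma LYM2 {V : Finset ℕ} {a c : ℕ} (hac : a ≤ c) {A C : Finset (Finset ℕ)}
    (hA : A ⊆ powersetCard a V) (hC : C ⊆ powersetCard c V)
    (h : ∀ X ∈ A, ∀ Y ∈ C, ¬ X ⊆ Y) :
    #A * (#V).choose c + #C * (#V).choose a ≤ (#V).choose a * (#V).choose c := by
  classical
  have key : #A * (#V - a).choose (c - a) ≤ #(powersetCard c V \ C) * c.choose a := by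
    refine card_mul_le_card_mul (fun X Y : Finset ℕ => X ⊆ Y) ?_ ?_
    · intro X hX
      obtain ⟨hXV, hXa⟩ := mem_powersetCard.1 (hA hX)
      have e : #(powersetCard (c - a) (V \ X)) = (#V - a).choose (c - a) := by
        rw [card_powersetCard, card_sdiff_of_subset hXV, hXa]
      rw [← e]
      refine card_le_card_of_injOn (fun Z => X ∪ Z) ?_ ?_
      · intro Z hZ
        obtain ⟨hZ1, hZ2⟩ := mem_powersetCard.1 (mem_coe.1 hZ)
        have hd : Disjoint X Z := (disjoint_sdiff (s := X) (t := V)).mono_right hZ1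
        simp only [coe_bipartiteAbove, mem_sdiff, mem_powersetCard]
        refine ⟨⟨⟨union_subset hXV (hZ1.trans sdiff_subset), ?_⟩, fun hc => h X hX _ hc subset_union_left⟩, subset_union_left⟩
        rw [card_union_of_disjoint hd]; omega
      · intro Z hZ Z' hZ' he
        have h1 := (mem_powersetCard.1 (mem_coe.1 hZ)).1
        have h2 := (mem_powersetCard.1 (mem_coe.1 hZ')).1
        have hd : Disjoint X Z := (disjoint_sdiff (s := X) (t := V)).mono_right h1
        have hd' : Disjoint X Z' := (disjoint_sdiff (s := X) (t := V)).mono_right h2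
        have he : X ∪ Z = X ∪ Z' := he
        rw [← union_sdiff_cancel_left hd, he, union_sdiff_cancel_left hd']
    · intro Y hY
      have hYc := (mem_powersetCard.1 (mem_sdiff.1 hY).1).2
      rw [← hYc, ← card_powersetCard]
      refine card_le_card ?_
      intro X hX
      rw [mem_bipartiteBelow] at hX
      exact mem_powersetCard.2 ⟨hX.2, (mem_powersetCard.1 (hA hX.1)).2⟩
  have hs : #(powersetCard c V \ C) + #C = (#V).choose c := by
    rw [card_sdiff_add_card_eq_card hC, card_powersetCard]
  have hm := Nat.choose_mul (n := #V) hac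
  set x := #(powersetCard c V \ C)
  refine Nat.le_of_mul_le_mul_right (c := c.choose a) ?_ (Nat.choose_pos hac)
  calc (#A * (#V).choose c + #C * (#V).choose a) * c.choose a
      = #A * ((#V).choose c * c.choose a) + #C * (#V).choose a * c.choose a := by ring
    _ = (#V).choose a * (#A * (#V - a).choose (c - a)) + #C * (#V).choose a * c.choose a := by rw [hm]; ring
    _ ≤ (#V).choose a * (x * c.choose a) + #C * (#V).choose a * c.choose a := by gcongr
    _ = (#V).choose a * (x + #C) * c.choose a := by ring
    _ = _ := by rw [hs]

/-- colex-final families (lex-initial after reversing the labels). -/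
def CF (p a : ℕ) (A : Finset (Finset ℕ)) : Prop :=
  A ⊆ powersetCard a (range p) ∧ ∀ s ∈ A, ∀ t ∈ powersetCard a (range p),
    toColex s ≤ toColex t → t ∈ A

lemma CF.dich {p a : ℕ} {A : Finset (Finset ℕ)} (h : CF (p+1) a A) :
    (∀ s ∈ A, p ∈ s) ∨ (∀ t ∈ powersetCard a (range (p+1)), p ∈ t → t ∈ A) := by
  by_contra! hh
  obtain ⟨⟨s, hs, hps⟩, t, ht, hpt, htA⟩ := hh
  refine htA (h.2 s hs t ht ?_)
  rw [Colex.toColex_le_toColex]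
  intro x hx _
  have := (mem_powersetCard.1 (h.1 hs)).1 hx
  exact ⟨p, hpt, hps, by rw [mem_range] at this; omega⟩

lemma sub_range_of_notMem {p : ℕ} {s : Finset ℕ} (hs : s ⊆ range (p+1)) (hp : p ∉ s) :
    s ⊆ range p := by
  intro x hx
  have := mem_range.1 (hs hx)
  have : x ≠ p := fun e => hp (e ▸ hx)
  exact mem_range.2 (by omega)

lemma range_sub_succ (p : ℕ) : range p ⊆ range (p+1) := by
  intro x; simp only [mem_range]; omega

lemma CF.restrict {p a : ℕ} {A : Finset (Finset ℕ)} (h : CF (p+1) a A) :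
    CF p a (A.filter (fun s => p ∉ s)) := by
  constructor
  · intro s hs
    obtain ⟨hs, hp⟩ := mem_filter.1 hs
    obtain ⟨h1, h2⟩ := mem_powersetCard.1 (h.1 hs)
    exact mem_powersetCard.2 ⟨sub_range_of_notMem h1 hp, h2⟩
  · intro s hs t ht hst
    obtain ⟨hs, hp⟩ := mem_filter.1 hs
    obtain ⟨h1, h2⟩ := mem_powersetCard.1 ht
    refine mem_filter.2 ⟨h.2 s hs t (mem_powersetCard.2 ⟨h1.trans (range_sub_succ p), h2⟩) hst, ?_⟩
    intro hpt
    have := mem_range.1 (h1 hpt)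
    omega

/-- families containing the top element: erase it. -/
lemma card_image_erase {p : ℕ} {A : Finset (Finset ℕ)} (h : ∀ s ∈ A, p ∈ s) :
    #(A.image (fun s => s.erase p)) = #A := by
  apply card_image_of_injOn
  intro s hs t ht he
  have he : s.erase p = t.erase p := he
  rw [← insert_erase (h s hs), he, insert_erase (h t ht)]

lemma image_erase_sub {p a : ℕ} {A : Finset (Finset ℕ)} (h : ∀ s ∈ A, p ∈ s)
    (hA : A ⊆ powersetCard (a+1) (range (p+1))) :
    A.image (fun s => s.erase p) ⊆ powersetCard a (range p) := by
  intro s hs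
  obtain ⟨t, ht, rfl⟩ := mem_image.1 hs
  obtain ⟨h1, h2⟩ := mem_powersetCard.1 (hA ht)
  refine mem_powersetCard.2 ⟨sub_range_of_notMem ((erase_subset _ _).trans h1) (notMem_erase _ _), ?_⟩
  rw [card_erase_of_mem (h t ht)]; omega

lemma card_star_le {p a : ℕ} {A : Finset (Finset ℕ)} (h : ∀ s ∈ A, p ∈ s)
    (hA : A ⊆ powersetCard (a+1) (range (p+1))) : #A ≤ p.choose a := by
  rw [← card_image_erase h]
  simpa using card_le_card (image_erase_sub h hA)

lemma card_nostar_le {p a : ℕ} {A : Finset (Finset ℕ)} (h : ∀ s ∈ A, p ∉ s)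
    (hA : A ⊆ powersetCard a (range (p+1))) : #A ≤ p.choose a := by
  have : A ⊆ powersetCard a (range p) := by
    intro s hs
    obtain ⟨h1, h2⟩ := mem_powersetCard.1 (hA hs)
    exact mem_powersetCard.2 ⟨sub_range_of_notMem h1 (h s hs), h2⟩
  simpa using card_le_card this

lemma arith_star {A C0 C1 Ia Ic Sa Sc K : ℕ} (h1 : A * Sc + C1 * Sa ≤ Sa * Sc) (hA : Sa = 0 → A = 0)
    (hC1 : C1 ≤ Sc) (hC0 : C0 ≤ K) (hx : Sa * Ic ≤ Sc * Ia) :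
    A * Ic + (C1 + C0) * Ia ≤ Ia * (Sc + K) := by
  have h2 : A * Ic + C1 * Ia ≤ Ia * Sc := by
    rcases Nat.eq_zero_or_pos Sa with h | h
    · rw [hA h]; nlinarith
    · refine Nat.le_of_mul_le_mul_right (c := Sa) ?_ h
      calc (A * Ic + C1 * Ia) * Sa = A * (Sa * Ic) + C1 * Ia * Sa := by ring
        _ ≤ A * (Sc * Ia) + C1 * Ia * Sa := by gcongr
        _ = Ia * (A * Sc + C1 * Sa) := by ring
        _ ≤ Ia * (Sa * Sc) := by gcongr
        _ = _ := by ring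
  nlinarith [Nat.mul_le_mul_left Ia hC0]

lemma arith_cont {A0 C0 Ia Ic Sa Sc K : ℕ} (h1 : A0 * Ic + C0 * Ia ≤ Ia * K) (hA : A0 ≤ Ia)
    (hC : C0 ≤ K) (hx : Sa * Ic ≤ Sc * Ia) :
    (Sa + A0) * (Sc + Ic) + C0 * (Sa + Ia) ≤ (Sa + Ia) * (Sc + K) := by
  obtain ⟨D, rfl⟩ := Nat.exists_eq_add_of_le hC
  obtain ⟨E, rfl⟩ := Nat.exists_eq_add_of_le hA
  have h1' : A0 * Ic ≤ (A0 + E) * D := by nlinarith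
  rcases Nat.eq_zero_or_pos (A0 + E) with h | h
  · have : A0 = 0 := by omega
    have : E = 0 := by omega
    subst A0 E
    nlinarith
  · have : Sa * Ic ≤ E * Sc + Sa * D := by
      refine Nat.le_of_mul_le_mul_right (c := A0 + E) ?_ h
      nlinarith [Nat.mul_le_mul_left Sa h1', Nat.mul_le_mul_left E hx]
    nlinarith

lemma mainL (p : ℕ) : ∀ (m a c : ℕ) (A C : Finset (Finset ℕ)), m ≤ p → a ≤ c → CF p a A →
    C ⊆ powersetCard c (range p) → (∀ X ∈ A, (X ∩ Ico (p - m) p).Nonempty) →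
    (∀ X ∈ A, ∀ Y ∈ C, ¬ X ⊆ Y) →
    #A ≤ II p a m ∧ #A * II p c m + #C * II p a m ≤ II p a m * p.choose c := by
  induction p with
  | zero =>
    intro m a c A C hm hac hA hC hM h
    have : A = ∅ := by
      rw [eq_empty_iff_forall_notMem]; intro X hX; simpa using hM X hX
    subst this
    have : m = 0 := by omega
    subst this
    simp [II]
  | succ p ih =>
    intro m a c A C hm hac hA hC hM h
    have hCc : #C ≤ (p+1).choose c := by simpa using card_le_card hC
    rcases A.eq_empty_or_nonempty with rfl | ⟨X0, hX0⟩
    · simp only [card_empty, zero_mul, zero_add, Nat.zero_le, true_and]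
      rw [mul_comm]; gcongr
    have ha : 1 ≤ a := by
      rw [← (mem_powersetCard.1 (hA.1 hX0)).2, one_le_card]
      exact (hM X0 hX0).mono inter_subset_left
    obtain ⟨a, rfl⟩ := Nat.exists_eq_add_of_le' ha
    obtain ⟨c, rfl⟩ := Nat.exists_eq_add_of_le' (ha.trans hac)
    have hm0 : m ≠ 0 := by rintro rfl; simpa using hM X0 hX0
    obtain ⟨m, rfl⟩ := Nat.exists_eq_succ_of_ne_zero hm0
    have hac' : a ≤ c := by omega
    have hm' : m ≤ p := by omega
    have hx := II_cross p a c m hm' hac'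
    have hx2 : p.choose a * (p.choose c + II p (c+1) m) ≤ p.choose c * (p.choose a + II p (a+1) m) := by
      rw [mul_add, mul_add, mul_comm (p.choose c) (p.choose a)]; omega
    rw [Nat.succ_eq_add_one, II_succ, II_succ, Nat.choose_succ_succ]
    set C1 := C.filter (fun s => p ∈ s) with hC1
    set C0 := C.filter (fun s => p ∉ s) with hC0
    have hCs : #C = #C1 + #C0 := (card_filter_add_card_filter_not (s := C) (fun s => p ∈ s)).symm
    have hC1p : ∀ s ∈ C1, p ∈ s := fun s hs => (mem_filter.1 hs).2
    have hC1s : C1 ⊆ powersetCard (c+1) (range (p+1)) := (filter_subset _ _).trans hC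
    have hC0p : ∀ s ∈ C0, p ∉ s := fun s hs => (mem_filter.1 hs).2
    have hC0s : C0 ⊆ powersetCard (c+1) (range (p+1)) := (filter_subset _ _).trans hC
    have hC1c := card_star_le hC1p hC1s
    have hC0c := card_nostar_le hC0p hC0s
    rcases hA.dich with hs | hs
    · have hAc := card_star_le hs hA.1
      refine ⟨by omega, ?_⟩
      rw [hCs]
      refine arith_star ?_ (fun h => by omega) hC1c hC0c hx2
      have := LYM2 hac' (image_erase_sub hs hA.1) (image_erase_sub hC1p hC1s) ?_
      · rwa [card_image_erase hs, card_image_erase hC1p, card_range] at this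
      · intro X hX Y hY hXY
        obtain ⟨X, hX', rfl⟩ := mem_image.1 hX
        obtain ⟨Y, hY', rfl⟩ := mem_image.1 hY
        refine h X hX' Y (mem_filter.1 hY').1 ?_
        rw [← insert_erase (hs X hX'), ← insert_erase (hC1p Y hY')]
        exact insert_subset_insert _ hXY
    · have hC1e : C1 = ∅ := by
        rw [eq_empty_iff_forall_notMem]
        intro Y hY
        obtain ⟨h1, h2⟩ := mem_powersetCard.1 (hC1s hY)
        obtain ⟨X, hX1, hX2, hX3⟩ := exists_subsuperset_card_eq (singleton_subset_iff.2 (hC1p Y hY)) (n := a+1) (by simp) (by omega)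
        exact h X (hs X (mem_powersetCard.2 ⟨hX2.trans h1, hX3⟩) (singleton_subset_iff.1 hX1)) Y (mem_filter.1 hY).1 hX2
      set A0 := A.filter (fun s => p ∉ s) with hA0
      set A1 := A.filter (fun s => p ∈ s) with hA1
      have hAs : #A = #A1 + #A0 := (card_filter_add_card_filter_not (s := A) (fun s => p ∈ s)).symm
      have hA1c : #A1 ≤ p.choose a := card_star_le (fun s hs => (mem_filter.1 hs).2) ((filter_subset _ _).trans hA.1)
      have := ih m (a+1) (c+1) A0 C0 hm' hac hA.restrict ?_ ?_ ?_
      · obtain ⟨i1, i2⟩ := this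
        refine ⟨by omega, ?_⟩
        have := arith_cont i2 i1 hC0c hx
        rw [hCs, hC1e, card_empty, zero_add, hAs]
        refine le_trans ?_ this
        gcongr
      · intro s hs
        obtain ⟨h1, h2⟩ := mem_powersetCard.1 (hC0s hs)
        exact mem_powersetCard.2 ⟨sub_range_of_notMem h1 (hC0p s hs), h2⟩
      · intro X hX
        obtain ⟨hX, hp⟩ := mem_filter.1 hX
        obtain ⟨x, hx⟩ := hM X hX
        rw [mem_inter, mem_Ico] at hx
        refine ⟨x, mem_inter.2 ⟨hx.1, mem_Ico.2 ?_⟩⟩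
        have : x ≠ p := fun e => hp (e ▸ hx.1)
        omega
      · intro X hX Y hY
        exact h X (mem_filter.1 hX).1 Y (mem_filter.1 hY).1
section Hilton
open Finset.Colex
open scoped FinsetFamily

lemma exists_initSeg_card (n k r : ℕ) (h : r ≤ n.choose k) :
    ∃ D : Finset (Finset (Fin n)), IsInitSeg D k ∧ #D = r := by
  induction r with
  | zero => exact ⟨∅, isInitSeg_empty, rfl⟩
  | succ r ih =>
    obtain ⟨D, hD, hr⟩ := ih (by omega)
    have hne : (powersetCard k (univ : Finset (Fin n)) \ D).Nonempty := by
      rw [← card_pos]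
      have := le_card_sdiff D (powersetCard k (univ : Finset (Fin n)))
      simp only [card_powersetCard, card_univ, Fintype.card_fin] at this
      omega
    obtain ⟨t, ht, hmin⟩ := exists_min_image _ (fun s => toColex s) hne
    obtain ⟨ht1, ht2⟩ := mem_sdiff.1 ht
    have htk := (mem_powersetCard.1 ht1).2
    refine ⟨insert t D, ⟨?_, ?_⟩, by rw [card_insert_of_notMem ht2, hr]⟩
    · intro s hs
      rcases mem_insert.1 (mem_coe.1 hs) with rfl | hs
      · exact htk
      · exact hD.1 hs
    · intro s u hs hu
      rcases mem_insert.1 hs with rfl | hs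
      · by_cases hu' : u ∈ D
        · exact mem_insert_of_mem hu'
        · have := hmin u (mem_sdiff.2 ⟨mem_powersetCard.2 ⟨subset_univ _, hu.2⟩, hu'⟩)
          exact absurd hu.1 (not_lt.2 this)
      · exact mem_insert_of_mem (hD.2 hs hu)

lemma toColex_compl_le {n : ℕ} {s t : Finset (Fin n)} (h : toColex s ≤ toColex t) :
    toColex tᶜ ≤ toColex sᶜ := by
  rw [toColex_le_toColex] at h ⊢
  intro a ha hb
  simp only [mem_compl, not_not] at ha hb
  obtain ⟨b, h1, h2, h3⟩ := h hb ha
  exact ⟨b, by simpa using h2, by simpa using h1, h3⟩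

lemma hiltonFin {n a b : ℕ} {F G D E : Finset (Finset (Fin n))} (hab : a + b ≤ n)
    (hD : IsInitSeg D a) (hE : IsInitSeg E b)
    (hF : (F : Set (Finset (Fin n))).Sized a) (hG : (G : Set (Finset (Fin n))).Sized b)
    (hDF : #D + #F = n.choose a) (hEG : #E + #G = n.choose b)
    (hc : ∀ X ∈ F, ∀ Y ∈ G, ¬ Disjoint X Y) {X Y : Finset (Fin n)}
    (hX : #X = a) (hXD : X ∉ D) (hY : #Y = b) (hYE : Y ∉ E) : ¬ Disjoint X Y := by
  classical
  intro hdis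
  set C : Finset (Finset (Fin n)) := (powersetCard b univ \ E).image compl with hCdef
  set G' : Finset (Finset (Fin n)) := G.image compl with hG'
  have hEs : E ⊆ powersetCard b univ := fun s hs => mem_powersetCard.2 ⟨subset_univ _, hE.1 hs⟩
  have hCinit : IsInitSeg C (n - b) := by
    constructor
    · intro s hs
      obtain ⟨Z, hZ, rfl⟩ := mem_image.1 (mem_coe.1 hs)
      rw [card_compl, (mem_powersetCard.1 (mem_sdiff.1 hZ).1).2, Fintype.card_fin]
    · intro s u hs hu
      obtain ⟨Z, hZ, rfl⟩ := mem_image.1 hs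
      obtain ⟨hZ1, hZ2⟩ := mem_sdiff.1 hZ
      refine mem_image.2 ⟨uᶜ, mem_sdiff.2 ⟨mem_powersetCard.2 ⟨subset_univ _, ?_⟩, ?_⟩, compl_compl u⟩
      · rw [card_compl, hu.2, Fintype.card_fin]; omega
      · intro huE
        apply hZ2
        refine hE.2 huE ⟨lt_of_le_of_ne ?_ ?_, (mem_powersetCard.1 hZ1).2⟩
        · simpa using toColex_compl_le hu.1.le
        · intro he
          have : Z = uᶜ := toColex_inj.1 he
          rw [this, compl_compl] at hu
          exact lt_irrefl _ hu.1
  have hCcard : #C = #G := by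
    rw [hCdef, card_image_of_injective _ compl_injective]
    have := card_sdiff_add_card_eq_card hEs
    simp only [card_powersetCard, card_univ, Fintype.card_fin] at this
    omega
  have hG'card : #G' = #G := card_image_of_injective _ compl_injective
  have hG's : (G' : Set (Finset (Fin n))).Sized (n - b) := by
    intro s hs
    obtain ⟨Z, hZ, rfl⟩ := mem_image.1 (mem_coe.1 hs)
    rw [card_compl, hG hZ, Fintype.card_fin]
  have hkk := iterated_kk (k := n - b - a) hG's (by omega) hCinit
  have hinit : ∀ j, IsInitSeg (∂^[j] C) (n - b - j) := by
    intro j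
    induction j with
    | zero => simpa using hCinit
    | succ j ih =>
      rw [Function.iterate_succ_apply', ← Nat.sub_sub]
      exact ih.shadow
  have hi := hinit (n - b - a)
  rw [show n - b - (n - b - a) = a by omega] at hi
  have hsub : ∂^[n - b - a] G' ⊆ powersetCard a univ \ F := by
    intro Z hZ
    obtain ⟨W, hW, hZW, hcard⟩ := mem_shadow_iterate_iff_exists_mem_card_add.1 hZ
    have := hG's hW
    refine mem_sdiff.2 ⟨mem_powersetCard.2 ⟨subset_univ _, by omega⟩, fun hZF => ?_⟩
    obtain ⟨V, hV, rfl⟩ := mem_image.1 hW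
    exact hc Z hZF V hV (disjoint_left.2 fun x hx => mem_compl.1 (hZW hx))
  have hFs : F ⊆ powersetCard a univ := fun s hs => mem_powersetCard.2 ⟨subset_univ _, hF hs⟩
  have h1 := card_le_card hsub
  have h2 := card_sdiff_add_card_eq_card hFs
  simp only [card_powersetCard, card_univ, Fintype.card_fin] at h2
  have hle : #(∂^[n - b - a] C) ≤ #D := by omega
  have hCD : ∂^[n - b - a] C ⊆ D := by
    rcases hi.total hD with h | h
    · exact h
    · rw [eq_of_subset_of_card_le h hle]
  apply hXD
  apply hCD
  refine mem_shadow_iterate_iff_exists_mem_card_add.2 ⟨Yᶜ, mem_image.2 ⟨Y, mem_sdiff.2 ⟨mem_powersetCard.2 ⟨subset_univ _, hY⟩, hYE⟩, rfl⟩, ?_, ?_⟩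
  · intro x hx
    exact mem_compl.2 (disjoint_left.1 hdis hx)
  · rw [card_compl, hY, hX, Fintype.card_fin]; omega

lemma exists_lex (n t : ℕ) (k : Fin t → ℕ) (F : Fin t → Finset (Finset ℕ))
    (hF : ∀ i, F i ⊆ ksubsets n (k i))
    (hcross : ∀ i j, i ≠ j → crossInt (F i) (F j)) :
    ∃ G : Fin t → Finset (Finset ℕ), (∀ i, CF n (k i) (G i)) ∧ (∀ i, #(G i) = #(F i)) ∧
      ∀ i j, i ≠ j → k i + k j ≤ n → ∀ X ∈ G i, ∀ Y ∈ G j, (X ∩ Y).Nonempty := by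
  classical
  set φ : Fin n → ℕ := fun x => x.val + 1 with hφ
  have hφi : Function.Injective φ := fun x y h => by
    simp only [hφ, Nat.add_right_cancel_iff] at h; exact Fin.ext h
  set H : Fin t → Finset (Finset (Fin n)) := fun i =>
    univ.filter (fun s => s.image φ ∈ F i) with hH
  have hHs : ∀ i, (H i : Set (Finset (Fin n))).Sized (k i) := by
    intro i s hs
    have := hF i (mem_filter.1 (mem_coe.1 hs)).2
    rw [← (mem_powersetCard.1 this).2, card_image_of_injective _ hφi]
  have hHc : ∀ i, #(H i) = #(F i) := by
    intro i
    have : (H i).image (fun s => s.image φ) = F i := by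
      ext Z
      constructor
      · intro hZ
        obtain ⟨s, hs, rfl⟩ := mem_image.1 hZ
        exact (mem_filter.1 hs).2
      · intro hZ
        have hZ' := (mem_powersetCard.1 (hF i hZ)).1
        have e : (univ.filter (fun x : Fin n => φ x ∈ Z)).image φ = Z := by
          ext z
          constructor
          · intro hz
            obtain ⟨x, hx, rfl⟩ := mem_image.1 hz
            exact (mem_filter.1 hx).2
          · intro hz
            have := mem_Icc.1 (hZ' hz)
            refine mem_image.2 ⟨⟨z - 1, by omega⟩, mem_filter.2 ⟨mem_univ _, ?_⟩, ?_⟩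
            · simp only [hφ]; rwa [Nat.sub_add_cancel this.1]
            · simp only [hφ]; omega
        exact mem_image.2 ⟨_, mem_filter.2 ⟨mem_univ _, by rwa [e]⟩, e⟩
    rw [← this, card_image_of_injective _ (image_injective hφi)]
  have hHle : ∀ i, #(H i) ≤ n.choose (k i) := by
    intro i
    have : H i ⊆ powersetCard (k i) univ := fun s hs => mem_powersetCard.2 ⟨subset_univ _, hHs i hs⟩
    simpa using card_le_card this
  choose D hD hDc using fun i => exists_initSeg_card n (k i) (n.choose (k i) - #(H i)) (Nat.sub_le _ _)
  have hvi : Function.Injective (fun s : Finset (Fin n) => s.image Fin.val) :=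
    image_injective Fin.val_injective
  refine ⟨fun i => (powersetCard (k i) univ \ D i).image (fun s => s.image Fin.val), ?_, ?_, ?_⟩
  · intro i
    constructor
    · intro s hs
      obtain ⟨u, hu, rfl⟩ := mem_image.1 hs
      refine mem_powersetCard.2 ⟨?_, ?_⟩
      · intro x hx
        obtain ⟨y, _, rfl⟩ := mem_image.1 hx
        exact mem_range.2 y.2
      · rw [card_image_of_injective _ Fin.val_injective]
        exact (mem_powersetCard.1 (mem_sdiff.1 hu).1).2
    · intro s hs v hv hsv
      obtain ⟨u, hu, rfl⟩ := mem_image.1 hs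
      obtain ⟨hu1, hu2⟩ := mem_sdiff.1 hu
      obtain ⟨hv1, hv2⟩ := mem_powersetCard.1 hv
      have e : (univ.filter (fun x : Fin n => x.val ∈ v)).image Fin.val = v := by
        ext z
        constructor
        · intro hz
          obtain ⟨x, hx, rfl⟩ := mem_image.1 hz
          exact (mem_filter.1 hx).2
        · intro hz
          exact mem_image.2 ⟨⟨z, mem_range.1 (hv1 hz)⟩, mem_filter.2 ⟨mem_univ _, hz⟩, rfl⟩
      set w := univ.filter (fun x : Fin n => x.val ∈ v)
      rw [← e] at hsv hv2 ⊢
      rw [toColex_image_le_toColex_image Fin.val_strictMono] at hsv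
      rw [card_image_of_injective _ Fin.val_injective] at hv2
      refine mem_image.2 ⟨w, mem_sdiff.2 ⟨mem_powersetCard.2 ⟨subset_univ _, hv2⟩, fun hw => ?_⟩, rfl⟩
      rcases hsv.eq_or_lt with h | h
      · exact hu2 (by rw [toColex_inj.1 h]; exact hw)
      · exact hu2 ((hD i).2 hw ⟨h, (mem_powersetCard.1 hu1).2⟩)
  · intro i
    have hDs : D i ⊆ powersetCard (k i) univ := fun s hs => mem_powersetCard.2 ⟨subset_univ _, (hD i).1 hs⟩
    have := card_sdiff_add_card_eq_card hDs
    simp only [card_powersetCard, card_univ, Fintype.card_fin] at this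
    rw [card_image_of_injective _ hvi, ← hHc i]
    have := hDc i
    have := hHle i
    omega
  · intro i j hij hk X hX Y hY
    obtain ⟨X, hX', rfl⟩ := mem_image.1 hX
    obtain ⟨Y, hY', rfl⟩ := mem_image.1 hY
    obtain ⟨hX1, hX2⟩ := mem_sdiff.1 hX'
    obtain ⟨hY1, hY2⟩ := mem_sdiff.1 hY'
    have hi1 := hDc i
    have hi2 := hHle i
    have hj1 := hDc j
    have hj2 := hHle j
    have := hiltonFin hk (hD i) (hD j) (hHs i) (hHs j) (by omega) (by omega) ?_
      (mem_powersetCard.1 hX1).2 hX2 (mem_powersetCard.1 hY1).2 hY2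
    · obtain ⟨x, h1, h2⟩ := not_disjoint_iff.1 this
      exact ⟨x.val, mem_inter.2 ⟨mem_image_of_mem _ h1, mem_image_of_mem _ h2⟩⟩
    · intro P hP Q hQ hd
      obtain ⟨x, hx⟩ := hcross i j hij _ (mem_filter.1 hP).2 _ (mem_filter.1 hQ).2
      obtain ⟨h1, h2⟩ := mem_inter.1 hx
      obtain ⟨y, hy, rfl⟩ := mem_image.1 h1
      obtain ⟨z, hz, he⟩ := mem_image.1 h2
      rw [hφi he] at hz
      exact disjoint_left.1 hd hy hz

end Hilton
lemma interp {ι : Type*} (SA SB : Finset ι) (A I B C J E : ι → ℕ)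
    (hA : ∀ i ∈ SA, A i ≤ I i) (hJ : ∀ j ∈ SB, J j + E j = C j) (hB : ∀ j ∈ SB, B j ≤ C j)
    (h : ∀ i ∈ SA, ∀ j ∈ SB, A i * J j + B j * I i ≤ I i * C j) :
    ∑ i ∈ SA, A i + ∑ j ∈ SB, B j ≤ max (∑ j ∈ SB, C j) (∑ i ∈ SA, I i + ∑ j ∈ SB, E j) := by
  have hx : ∃ x : ℚ, 0 ≤ x ∧ x ≤ 1 ∧ (∀ i ∈ SA, (A i : ℚ) ≤ x * I i) ∧
      ∀ j ∈ SB, (B j : ℚ) ≤ C j - x * J j := by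
    rcases SA.eq_empty_or_nonempty with rfl | hne
    · exact ⟨0, le_rfl, zero_le_one, by simp, fun j hj => by simpa using hB j hj⟩
    obtain ⟨i0, hi0, hmax⟩ := exists_max_image SA (fun i => (A i : ℚ) / I i) hne
    refine ⟨(A i0 : ℚ) / I i0, by positivity, ?_, ?_, ?_⟩
    · apply div_le_one_of_le₀ _ (by positivity)
      exact_mod_cast hA i0 hi0
    · intro i hi
      rcases Nat.eq_zero_or_pos (I i) with h0 | h0
      · have := hA i hi
        have : A i = 0 := by omega
        simp [this, h0]
      · have h0' : (0 : ℚ) < I i := by exact_mod_cast h0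
        have := hmax i hi
        rwa [div_le_iff₀ h0'] at this
    · intro j hj
      rcases Nat.eq_zero_or_pos (I i0) with h0 | h0
      · simpa [h0] using hB j hj
      · have h0' : (0 : ℚ) < I i0 := by exact_mod_cast h0
        have h1 : (A i0 : ℚ) * J j + B j * I i0 ≤ I i0 * C j := by exact_mod_cast h i0 hi0 j hj
        rw [le_sub_iff_add_le, div_mul_eq_mul_div, ← le_sub_iff_add_le', div_le_iff₀ h0']
        linarith
  obtain ⟨x, hx0, hx1, hxA, hxB⟩ := hx
  have s1 : (∑ i ∈ SA, (A i : ℚ)) ≤ x * ∑ i ∈ SA, (I i : ℚ) := by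
    rw [mul_sum]; exact sum_le_sum hxA
  have s2 : (∑ j ∈ SB, (B j : ℚ)) ≤ ∑ j ∈ SB, (C j : ℚ) - x * (∑ j ∈ SB, (C j : ℚ) - ∑ j ∈ SB, (E j : ℚ)) := by
    rw [← sum_sub_distrib, mul_sum, ← sum_sub_distrib]
    refine sum_le_sum fun j hj => ?_
    have := hxB j hj
    have e : (J j : ℚ) = C j - E j := by
      rw [← hJ j hj]; push_cast; ring
    rwa [e] at this
  have goal : ((∑ i ∈ SA, A i + ∑ j ∈ SB, B j : ℕ) : ℚ) ≤
      ((max (∑ j ∈ SB, C j) (∑ i ∈ SA, I i + ∑ j ∈ SB, E j) : ℕ) : ℚ) := by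
    push_cast
    set a := ∑ i ∈ SA, (A i : ℚ)
    set b := ∑ j ∈ SB, (B j : ℚ)
    set c := ∑ j ∈ SB, (C j : ℚ)
    set e := ∑ j ∈ SB, (E j : ℚ)
    set f := ∑ i ∈ SA, (I i : ℚ)
    have m1 := le_max_left c (f + e)
    have m2 := le_max_right c (f + e)
    nlinarith [mul_nonneg hx0 (sub_nonneg.2 m2), mul_nonneg (sub_nonneg.2 hx1) (sub_nonneg.2 m1)]
  exact_mod_cast goal

lemma CF.top_mem {p m : ℕ} (hm : m ≤ p) {A : Finset (Finset ℕ)} (h : CF (p+1) (m+1) A)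
    (hne : A.Nonempty) : Ico (p - m) (p+1) ∈ A := by
  obtain ⟨s, hs⟩ := hne
  obtain ⟨h1, h2⟩ := mem_powersetCard.1 (h.1 hs)
  have hc : #(Ico (p - m) (p+1)) = m + 1 := by rw [Nat.card_Ico]; omega
  refine h.2 s hs _ (mem_powersetCard.2 ⟨?_, hc⟩) ?_
  · intro x hx
    rw [mem_Ico] at hx
    exact mem_range.2 hx.2
  · rw [Colex.toColex_le_toColex]
    intro a ha hna
    have : ¬ Ico (p - m) (p+1) ⊆ s := by
      intro hsub
      rw [eq_of_subset_of_card_le hsub (by omega)] at hna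
      exact hna ha
    obtain ⟨b, hb, hbs⟩ := not_subset.1 this
    refine ⟨b, hb, hbs, ?_⟩
    have := mem_range.1 (h1 ha)
    rw [mem_Ico] at hna hb
    omega

lemma core (p t : ℕ) (k : Fin t → ℕ) (G : Fin t → Finset (Finset ℕ)) (S : Finset (Fin t))
    (l : Fin t) (hl : l ∉ S) (hpos : ∀ i, 1 ≤ k i) (hkn : ∀ i, k i ≤ p + 1)
    (hCF : ∀ i, CF (p+1) (k i) (G i)) (hstar : ∀ j, j ∉ S → ∀ s ∈ G j, p ∈ s)
    (hsum : ∀ i ∈ S, ∀ j, j ∉ S → k i + k j ≤ p + 1) (hmin : ∀ j, j ∉ S → k l ≤ k j)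
    (hc : ∀ i ∈ S, ∀ j, j ∉ S → ∀ X ∈ G i, ∀ Y ∈ G j, (X ∩ Y).Nonempty)
    (hne : (G l).Nonempty) :
    ∑ i, #(G i) ≤ max (∑ i, p.choose (k i - 1))
      (∑ i ∈ S, II (p+1) (k i) (k l) + ∑ j ∈ Sᶜ, (p + 1 - k l).choose (k j - k l)) := by
  classical
  obtain ⟨m, hm⟩ := Nat.exists_eq_add_of_le' (hpos l)
  have hmp : m ≤ p := by have := hkn l; omega
  have hT : Ico (p - m) (p+1) ∈ G l := by
    have := hCF l
    rw [hm] at this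
    exact this.top_mem hmp hne
  have hML : ∀ i ∈ S, ∀ j, j ∉ S →
      #((G i).filter (fun s => p ∉ s)) ≤ II p (k i) m ∧
      #((G i).filter (fun s => p ∉ s)) * II p (p + 1 - k j) m + #(G j) * II p (k i) m
        ≤ II p (k i) m * p.choose (p + 1 - k j) := by
    intro i hi j hj
    have hcard : #((G j).image (fun Y => range p \ Y)) = #(G j) := by
      apply card_image_of_injOn
      intro Y hY Z hZ he
      have he : range p \ Y = range p \ Z := he
      have hY1 := (mem_powersetCard.1 ((hCF j).1 hY)).1
      have hZ1 := (mem_powersetCard.1 ((hCF j).1 hZ)).1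
      have hYp := hstar j hj Y hY
      have hZp := hstar j hj Z hZ
      ext x
      have hx := congrArg (fun W => x ∈ W) he
      simp only [mem_sdiff, mem_range, eq_iff_iff] at hx
      by_cases hxp : x < p
      · tauto
      · constructor
        · intro h
          have := mem_range.1 (hY1 h)
          have : x = p := by omega
          rwa [this]
        · intro h
          have := mem_range.1 (hZ1 h)
          have : x = p := by omega
          rwa [this]
    rw [← hcard]
    refine mainL p m (k i) (p + 1 - k j) _ _ hmp (by have := hsum i hi j hj; omega)
      (hCF i).restrict ?_ ?_ ?_
    · intro s hs
      obtain ⟨Y, hY, rfl⟩ := mem_image.1 hs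
      obtain ⟨hY1, hY2⟩ := mem_powersetCard.1 ((hCF j).1 hY)
      have hYp := hstar j hj Y hY
      refine mem_powersetCard.2 ⟨sdiff_subset, ?_⟩
      have e : range p \ Y = range (p+1) \ Y := by
        ext x
        simp only [mem_sdiff, mem_range]
        constructor
        · rintro ⟨h1, h2⟩; exact ⟨by omega, h2⟩
        · rintro ⟨h1, h2⟩
          refine ⟨?_, h2⟩
          have : x ≠ p := fun e => h2 (e ▸ hYp)
          omega
      rw [e, card_sdiff_of_subset hY1, card_range, hY2]
    · intro X hX
      obtain ⟨hX, hXp⟩ := mem_filter.1 hX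
      obtain ⟨x, hx⟩ := hc i hi l hl X hX _ hT
      rw [mem_inter, mem_Ico] at hx
      have : x ≠ p := fun e => hXp (e ▸ hx.1)
      exact ⟨x, mem_inter.2 ⟨hx.1, mem_Ico.2 (by omega)⟩⟩
    · intro X hX Y hY hXY
      obtain ⟨Y, hY', rfl⟩ := mem_image.1 hY
      obtain ⟨x, hx⟩ := hc i hi j hj X (mem_filter.1 hX).1 Y hY'
      rw [mem_inter] at hx
      exact (mem_sdiff.1 (hXY hx.1)).2 hx.2
  have hsymm : ∀ j, p.choose (p + 1 - k j) = p.choose (k j - 1) := by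
    intro j
    have h1 := hpos j
    have h2 := hkn j
    rw [← Nat.choose_symm (show k j - 1 ≤ p by omega)]
    congr 1; omega
  have hsub : ∀ i, k i = k i - 1 + 1 := fun i => by have := hpos i; omega
  have hitp := interp S Sᶜ (fun i => #((G i).filter (fun s => p ∉ s))) (fun i => II p (k i) m)
    (fun j => #(G j)) (fun j => p.choose (k j - 1)) (fun j => II p (p + 1 - k j) m)
    (fun j => (p - m).choose (p + 1 - k j))
    (fun i hi => (hML i hi l hl).1)
    (fun j _ => by rw [II_add, hsymm])
    (fun j hj => by
      have := (hCF j).1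
      rw [hsub j] at this
      exact card_star_le (hstar j (mem_compl.1 hj)) this)
    (fun i hi j hj => by
      have := (hML i hi j (mem_compl.1 hj)).2
      rwa [hsymm] at this)
  have hsplit : ∑ i ∈ S, #(G i) ≤ ∑ i ∈ S, p.choose (k i - 1) + ∑ i ∈ S, #((G i).filter (fun s => p ∉ s)) := by
    rw [← sum_add_distrib]
    refine sum_le_sum fun i _ => ?_
    rw [← card_filter_add_card_filter_not (s := G i) (fun s => p ∈ s)]
    gcongr
    refine card_star_le (fun s hs => (mem_filter.1 hs).2) ?_
    rw [← hsub i]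
    exact (filter_subset _ _).trans (hCF i).1
  have e1 : ∑ i ∈ S, II (p+1) (k i) (k l) = ∑ i ∈ S, p.choose (k i - 1) + ∑ i ∈ S, II p (k i) m := by
    rw [← sum_add_distrib]
    refine sum_congr rfl fun i _ => ?_
    have := II_succ p (k i - 1) m
    rwa [← hsub i, ← hm] at this
  have e2 : ∑ j ∈ Sᶜ, (p + 1 - k l).choose (k j - k l) = ∑ j ∈ Sᶜ, (p - m).choose (p + 1 - k j) := by
    refine sum_congr rfl fun j hj => ?_
    have h1 := hmin j (mem_compl.1 hj)
    have h2 := hkn j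
    rw [← Nat.choose_symm (show k j - k l ≤ p + 1 - k l by omega)]
    congr 1 <;> omega
  have e3 := sum_add_sum_compl S (fun i => #(G i))
  have e4 := sum_add_sum_compl S (fun i => p.choose (k i - 1))
  rw [← e3, ← e4, e1, e2]
  omega

/-- number of `k`-subsets of an `(m+q)`-set splitting a fixed `m`-subset. -/
def WW (m : ℕ) : ℕ → ℕ → ℕ
  | 0, k => if k = 0 ∨ m ≤ k then 0 else m.choose k
  | _ + 1, 0 => 0
  | q + 1, k + 1 => WW m q k + WW m q (k + 1)

lemma WW_zero (m q : ℕ) : WW m q 0 = 0 := by cases q <;> simp [WW]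

lemma WW_formula (m : ℕ) (hm : 1 ≤ m) (q k : ℕ) :
    WW m q k + q.choose k + (if m ≤ k then q.choose (k - m) else 0) = (m + q).choose k := by
  induction q generalizing k with
  | zero =>
    rcases Nat.eq_zero_or_pos k with rfl | hk
    · have : ¬ m ≤ 0 := by omega
      simp [WW, this]
    · rw [Nat.choose_eq_zero_of_lt hk]
      rcases lt_trichotomy k m with h | h | h
      · have h1 : ¬ m ≤ k := by omega
        have h2 : k ≠ 0 := by omega
        simp [WW, h1, h2]
      · subst h; simp [WW]
      · have h1 : m ≤ k := by omega
        simp [WW, h1, Nat.choose_eq_zero_of_lt h, Nat.choose_eq_zero_of_lt (show 0 < k - m by omega)]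
  | succ q ih =>
    cases k with
    | zero =>
      have : ¬ m ≤ 0 := by omega
      simp [WW, this]
    | succ k =>
      have h1 := ih k
      have h2 := ih (k+1)
      rw [← add_assoc, Nat.choose_succ_succ', Nat.choose_succ_succ']
      simp only [WW]
      rcases lt_trichotomy (k+1) m with h | h | h
      · rw [if_neg (by omega)] at h1 h2 ⊢
        omega
      · rw [if_neg (by omega)] at h1
        rw [if_pos (by omega)] at h2 ⊢
        rw [show k + 1 - m = 0 by omega, Nat.choose_zero_right] at h2 ⊢
        omega
      · rw [if_pos (by omega)] at h1 h2 ⊢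
        rw [show k + 1 - m = k - m + 1 by omega] at h2 ⊢
        rw [Nat.choose_succ_succ']
        omega

lemma WW_symm (m : ℕ) (hm : 1 ≤ m) (q k : ℕ) (hk : k ≤ m + q) : WW m q (m + q - k) = WW m q k := by
  have aux : ∀ j ≤ m + q, q.choose (m + q - j) = if m ≤ j then q.choose (j - m) else 0 := by
    intro j hj
    split_ifs with h
    · rw [← Nat.choose_symm (show j - m ≤ q by omega)]; congr 1; omega
    · exact Nat.choose_eq_zero_of_lt (by omega)
  have h1 := WW_formula m hm q k
  have h2 := WW_formula m hm q (m + q - k)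
  rw [← aux k hk] at h1
  rw [← aux (m + q - k) (by omega), Nat.choose_symm hk, Nat.sub_sub_self hk] at h2
  omega

lemma choose_le_of_add_le {n m m' : ℕ} (h : m ≤ m') (hn : m + m' ≤ n) : n.choose m ≤ n.choose m' := by
  have h1 := Nat.choose_mul (n := n) h
  have h2 : m'.choose m ≤ (n - m).choose (m' - m) := by
    rw [← Nat.choose_symm h]
    exact Nat.choose_le_choose _ (by omega)
  refine Nat.le_of_mul_le_mul_right (c := m'.choose m) ?_ (Nat.choose_pos h)
  rw [h1]
  gcongr

lemma WW_mono (m : ℕ) (hm : 1 ≤ m) (q k k' : ℕ) (h : k ≤ k') (hs : k + k' ≤ m + q) :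
    WW m q k ≤ WW m q k' := by
  induction q generalizing k k' with
  | zero =>
    rcases Nat.eq_zero_or_pos k with rfl | hk
    · simp [WW]
    · have h1 : ¬ (k = 0 ∨ m ≤ k) := by omega
      have h2 : ¬ (k' = 0 ∨ m ≤ k') := by omega
      simp only [WW, if_neg h1, if_neg h2]
      exact choose_le_of_add_le h (by omega)
  | succ q ih =>
    cases k with
    | zero => simp [WW]
    | succ k =>
      obtain ⟨k', rfl⟩ : ∃ j, k' = j + 1 := ⟨k' - 1, by omega⟩
      simp only [WW]
      rcases Nat.lt_or_ge (m + q) (k + 1 + (k' + 1)) with hh | hh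
      · have h1 := WW_symm m hm q (k' + 1) (by omega)
        have h2 := WW_symm m hm q k' (by omega)
        rw [show m + q - (k' + 1) = k by omega] at h1
        rw [show m + q - k' = k + 1 by omega] at h2
        omega
      · exact add_le_add (ih k k' (by omega) (by omega)) (ih _ _ h hh)

lemma II_eq_WW {n k m : ℕ} (hm : 1 ≤ m) (hmn : m ≤ n) (hk : m ≤ k) :
    II n k m = WW m (n - m) k + (n - m).choose (k - m) := by
  have h1 := WW_formula m hm (n - m) k
  have h2 := II_add n k m
  rw [if_pos hk, Nat.add_sub_cancel' hmn] at h1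
  omega

lemma II_swap {n m m' : ℕ} (h : m ≤ m') (hn : m + m' ≤ n) : II n m m' ≤ II n m' m := by
  have h1 := II_add n m m'
  have h2 := II_add n m' m
  have h3 := choose_le_of_add_le h hn
  have h4 : n.choose m' * (n - m').choose m = n.choose m * (n - m).choose m' := by
    have a1 := Nat.choose_mul (n := n) (k := m + m') (s := m) (by omega)
    have a2 := Nat.choose_mul (n := n) (k := m + m') (s := m') (by omega)
    rw [Nat.add_sub_cancel_left] at a1
    rw [Nat.add_sub_cancel, ← Nat.choose_symm (by omega : m' ≤ m + m'), Nat.add_sub_cancel] at a2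
    rw [← a1, ← a2]
  have hX : 0 < n.choose m := Nat.choose_pos (by omega)
  refine Nat.le_of_mul_le_mul_right (c := n.choose m) ?_ hX
  have : II n m m' * n.choose m' = II n m' m * n.choose m := by
    zify at h1 h2 h4 ⊢
    have e1 : (II n m m' : ℤ) = n.choose m - (n - m').choose m := by linarith
    have e2 : (II n m' m : ℤ) = n.choose m' - (n - m).choose m' := by linarith
    rw [e1, e2]
    linear_combination -h4
  rw [← this]
  gcongr

lemma choose_shift {n m m' k : ℕ} (h : m ≤ m') (hk : m' ≤ k) (hn : k ≤ n) :
    (n - m').choose (k - m') ≤ (n - m).choose (k - m) := by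
  rw [← Nat.choose_symm (show k - m' ≤ n - m' by omega), ← Nat.choose_symm (show k - m ≤ n - m by omega),
    show n - m' - (k - m') = n - k by omega, show n - m - (k - m) = n - k by omega]
  exact Nat.choose_le_choose _ (by omega)

theorem stmt2 (n t : ℕ) (ht : 3 ≤ t) (k : Fin t → ℕ)
    (hpos : ∀ i, 1 ≤ k i)
    (hmono : ∀ i j : Fin t, i ≤ j → k j ≤ k i)
    (hn1 : k ⟨0, by omega⟩ + k ⟨2, by omega⟩ ≤ n)
    (hn2 : n < k ⟨0, by omega⟩ + k ⟨1, by omega⟩)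
    (F : Fin t → Finset (Finset ℕ))
    (hF : ∀ i, F i ⊆ ksubsets n (k i)) (hne : ∀ i, (F i).Nonempty)
    (hcross : ∀ i j, i ≠ j → crossInt (F i) (F j)) :
    ∑ i, (F i).card ≤
      max (∑ i, (n - 1).choose (k i - 1))
        ((n.choose (k ⟨0, by omega⟩) - (n - k ⟨t - 1, by omega⟩).choose (k ⟨0, by omega⟩)) +
         (n.choose (k ⟨1, by omega⟩) - (n - k ⟨t - 1, by omega⟩).choose (k ⟨1, by omega⟩)) +
         ∑ i ∈ Finset.univ.filter (fun i : Fin t => 2 ≤ (i : ℕ)),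
           (n - k ⟨t - 1, by omega⟩).choose (k i - k ⟨t - 1, by omega⟩)) := by
  classical
  set i0 : Fin t := ⟨0, by omega⟩ with hi0
  set i1 : Fin t := ⟨1, by omega⟩ with hi1
  set i2 : Fin t := ⟨2, by omega⟩ with hi2
  set la : Fin t := ⟨t - 1, by omega⟩ with hla
  obtain ⟨G, hCF, hcard, hGc⟩ := exists_lex n t k F hF hcross
  have hGne : ∀ i, (G i).Nonempty := fun i => by
    rw [← card_pos, hcard]; exact card_pos.2 (hne i)
  obtain ⟨p, rfl⟩ : ∃ p, n = p + 1 := ⟨n - 1, by have := hpos i0; omega⟩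
  have hk0 : ∀ i, k i ≤ k i0 := fun i => hmono i0 i (by simp [hi0, Fin.le_def])
  have hk2 : ∀ i : Fin t, 2 ≤ i.val → k i ≤ k i2 := fun i hi => hmono i2 i (by simpa [hi2, Fin.le_def] using hi)
  have hkl : ∀ i, k la ≤ k i := fun i => hmono i la (by
    rw [Fin.le_def]; have := i.2; simp only [hla]; omega)
  have hkn : ∀ i, k i ≤ p + 1 := fun i => by have := hk0 i; omega
  have hla2 : 2 ≤ la.val := by simp only [hla]; omega
  have h01 : i0 ≠ i1 := by simp [hi0, hi1, Fin.ext_iff]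
  have hSc : ({i0, i1} : Finset (Fin t))ᶜ = Finset.univ.filter (fun i : Fin t => 2 ≤ (i : ℕ)) := by
    ext j
    simp only [mem_compl, mem_insert, mem_singleton, mem_filter, mem_univ, true_and, hi0, hi1, Fin.ext_iff]
    omega
  have hmemS : ∀ j : Fin t, j ∉ ({i0, i1} : Finset (Fin t)) → 2 ≤ j.val := by
    intro j hj
    rw [← mem_compl, hSc] at hj
    simpa using hj
  rw [← hSc, ← sum_congr rfl (fun i _ => hcard i)]
  change _ ≤ max _ (II (p+1) (k i0) (k la) + II (p+1) (k i1) (k la) + _)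
  rw [Nat.add_sub_cancel]
  by_cases hcase : ∀ j : Fin t, 2 ≤ j.val → ∀ s ∈ G j, p ∈ s
  · have := core p t k G {i0, i1} la ?_ hpos hkn hCF (fun j hj => hcase j (hmemS j hj)) ?_
      (fun j _ => hkl j) ?_ (hGne la)
    · rwa [sum_pair h01] at this
    · rw [← mem_compl, hSc]; simpa using hla2
    · intro i _ j hj
      have := hk0 i
      have := hk2 j (hmemS j hj)
      omega
    · intro i hi j hj
      have := hk0 i
      have := hk2 j (hmemS j hj)
      exact hGc i j (fun e => hj (e ▸ hi)) (by omega)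
  · push Not at hcase
    obtain ⟨i, hi2', s, hs, hps⟩ := hcase
    have hfull : ∀ t ∈ powersetCard (k i) (range (p+1)), p ∈ t → t ∈ G i := by
      rcases (hCF i).dich with h | h
      · exact absurd (h s hs) hps
      · exact h
    have hki : ∀ j, j ≠ i → k i + k j ≤ p + 1 := by
      intro j _
      have := hk0 j
      have := hk2 i hi2'
      omega
    have hothers : ∀ j, j ≠ i → ∀ Y ∈ G j, p ∈ Y := by
      intro j hj Y hY
      by_contra hpY
      obtain ⟨hY1, hY2⟩ := mem_powersetCard.1 ((hCF j).1 hY)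
      have hYr := sub_range_of_notMem hY1 hpY
      have hc : #(range p \ Y) = p - k j := by rw [card_sdiff_of_subset hYr, card_range, hY2]
      have hk := hki j hj
      have hk' := hpos i
      obtain ⟨Z, hZ1, hZ2⟩ := exists_subset_card_eq (show k i - 1 ≤ #(range p \ Y) by omega)
      have hpZ : p ∉ Z := fun h => by
        have := hZ1 h
        simp at this
      have hX : insert p Z ∈ G i := by
        refine hfull _ (mem_powersetCard.2 ⟨?_, ?_⟩) (mem_insert_self _ _)
        · refine insert_subset (by simp) ?_
          exact (hZ1.trans sdiff_subset).trans (range_sub_succ p)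
        · rw [card_insert_of_notMem hpZ]; omega
      obtain ⟨x, hx⟩ := hGc i j hj.symm hk _ hX Y hY
      rw [mem_inter, mem_insert] at hx
      rcases hx with ⟨rfl | hx, hxY⟩
      · exact hpY hxY
      · exact (mem_sdiff.1 (hZ1 hx)).2 hxY
    set m := k la with hm
    have hm1 : 1 ≤ m := hpos la
    have hII : ∀ j, II (p+1) (k j) m = WW m (p + 1 - m) (k j) + (p + 1 - m).choose (k j - m) :=
      fun j => II_eq_WW hm1 (hkn la) (hkl j)
    have hWW : ∀ j, WW m (p + 1 - m) (k j) ≤ WW m (p + 1 - m) (k i0) + WW m (p + 1 - m) (k i1) := by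
      intro j
      by_cases hj0 : j = i0
      · rw [hj0]; omega
      by_cases hj1 : j = i1
      · rw [hj1]; omega
      have hj : 2 ≤ j.val := hmemS j (by simp [hj0, hj1])
      have := hk2 j hj
      have := hkn la
      exact (WW_mono m hm1 _ _ _ (hk0 j) (by omega)).trans (Nat.le_add_right _ _)
    have htarget : II (p+1) (k i0) m + II (p+1) (k i1) m +
        ∑ j ∈ ({i0, i1} : Finset (Fin t))ᶜ, (p + 1 - m).choose (k j - m) =
        WW m (p + 1 - m) (k i0) + WW m (p + 1 - m) (k i1) + ∑ j, (p + 1 - m).choose (k j - m) := by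
      rw [hII, hII, ← sum_add_sum_compl {i0, i1} (fun j => (p + 1 - m).choose (k j - m)), sum_pair h01]
      ring
    rw [htarget]
    have hcore : ∀ l, l ≠ i → (∀ j, j ≠ i → k l ≤ k j) → _ := fun l hl hmin =>
      core p t k G {i} l (by simpa using hl) hpos hkn hCF
        (fun j hj => hothers j (by simpa using hj))
        (fun i' hi' j hj => by
          rw [mem_singleton.1 hi']; exact hki j (by simpa using hj))
        (fun j hj => hmin j (by simpa using hj))
        (fun i' hi' j hj => by
          rw [mem_singleton.1 hi']
          have hj' : j ≠ i := by simpa using hj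
          exact hGc i j hj'.symm (hki j hj'))
        (hGne l)
    by_cases hil : i = la
    · -- the last family is the big one
      set l : Fin t := ⟨t - 2, by omega⟩ with hl
      have hlla : l ≠ la := by
        simp only [hl, hla, ne_eq, Fin.ext_iff]; omega
      have hlmin : ∀ j, j ≠ i → k l ≤ k j := by
        intro j hj
        refine hmono j l ?_
        have h1 : j.val ≠ t - 1 := fun e => hj (by rw [hil]; exact Fin.ext e)
        rw [Fin.le_def]
        have := j.2
        simp only [hl]; omega
      refine (hcore l (by rw [hil]; exact hlla) hlmin).trans (max_le_max le_rfl ?_)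
      rw [sum_singleton]
      have s1 : II (p+1) (k i) (k l) ≤ II (p+1) (k l) m := by
        rw [hil]
        refine II_swap (hkl l) ?_
        have := hki l (by rw [hil]; exact hlla)
        rwa [hil] at this
      have s2 : ∑ j ∈ ({i} : Finset (Fin t))ᶜ, (p + 1 - k l).choose (k j - k l)
          = 1 + ∑ j ∈ (({i} : Finset (Fin t))ᶜ).erase l, (p + 1 - k l).choose (k j - k l) := by
        rw [← add_sum_erase _ _ (show l ∈ ({i} : Finset (Fin t))ᶜ by simpa [hil] using hlla)]
        simp
      have s3 : ∑ j, (p + 1 - m).choose (k j - m) = 1 + ((p + 1 - m).choose (k l - m) +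
          ∑ j ∈ (({i} : Finset (Fin t))ᶜ).erase l, (p + 1 - m).choose (k j - m)) := by
        rw [← sum_add_sum_compl {i} (fun j => (p + 1 - m).choose (k j - m)), sum_singleton,
          ← add_sum_erase _ _ (show l ∈ ({i} : Finset (Fin t))ᶜ by simpa [hil] using hlla), hil]
        simp [hm]
      have s4 : ∑ j ∈ (({i} : Finset (Fin t))ᶜ).erase l, (p + 1 - k l).choose (k j - k l) ≤
          ∑ j ∈ (({i} : Finset (Fin t))ᶜ).erase l, (p + 1 - m).choose (k j - m) := by
        refine sum_le_sum fun j hj => ?_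
        have hj' : j ≠ i := by
          have := (mem_erase.1 hj).2
          simpa using this
        exact choose_shift (hkl l) (hlmin j hj') (hkn j)
      have s5 := hII l
      have s6 := hWW l
      omega
    · refine (hcore la (fun e => hil e.symm) (fun j _ => hkl j)).trans (max_le_max le_rfl ?_)
      rw [sum_singleton, ← sum_add_sum_compl {i} (fun j => (p + 1 - m).choose (k j - m)), sum_singleton]
      have s5 := hII i
      have s6 := hWW i
      rw [← hm]
      omega
end
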